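/- (Termwise spatial differentiation.) Under the same hypotheses, with the same Aₙ, Bₙ, Cₙ as above, the termwise twice-differentiated-in-x series Σ_{n=1}^∞ (nπ/L)²·(Aₙ(t) + Bₙ(t) + Cₙ(t))·sin(nπx/L) also converges absolutely and uniformly on [0,T]×[0,L]; in particular, the sum v(t,x) = Σ_{n=1}^∞ (Aₙ(t)+Bₙ(t)+Cₙ(t))·sin(nπx/L) is twice continuously differentiable in x on [0,T]×[0,L] and ∂_{xx}v is obtained by termwise differentiation. -/

import Mathlib

/-- Single term of the double series defining the delayed perturbation cosine function. -/
noncomputable def Cterm (τ a b t : ℝ) (k m : ℕ) : ℝ :=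
  if k ≤ m then
    (m.choose k : ℝ) * a ^ (m - k) * b ^ k * (max (t - (k : ℝ) * τ) 0) ^ (2 * m) /
      (Nat.factorial (2 * m) : ℝ)
  else 0

/-- Single term of the double series defining the delayed perturbation sine function. -/
noncomputable def Sterm (τ a b t : ℝ) (k m : ℕ) : ℝ :=
  if k ≤ m then
    (m.choose k : ℝ) * a ^ (m - k) * b ^ k * (max (t - (k : ℝ) * τ) 0) ^ (2 * m + 1) /
      (Nat.factorial (2 * m + 1) : ℝ)
  else 0

/-- The delayed perturbation cosine-type function `C_τ^{a,b}`, extended by `0` for `t < 0`. -/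
noncomputable def Cdel (τ a b : ℝ) (t : ℝ) : ℝ :=
  if t < 0 then 0 else ∑' k : ℕ, ∑' m : ℕ, Cterm τ a b t k m

/-- The delayed perturbation sine-type function `S_τ^{a,b}`, extended by `0` for `t < 0`. -/
noncomputable def Sdel (τ a b : ℝ) (t : ℝ) : ℝ :=
  if t < 0 then 0 else ∑' k : ℕ, ∑' m : ℕ, Sterm τ a b t k m

/-- The series multiplying the `k`-th delay in `Cdel`, as a function of the shifted time `s`. -/
noncomputable def cosKernel (a b : ℝ) (k : ℕ) (s : ℝ) : ℝ :=
  ∑' m : ℕ, (m.choose k : ℝ) * a ^ (m - k) * b ^ k * s ^ (2 * m) / ((2 * m).factorial : ℝ)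

/-- The series multiplying the `k`-th delay in `Sdel`, as a function of the shifted time `s`. -/
noncomputable def sinKernel (a b : ℝ) (k : ℕ) (s : ℝ) : ℝ :=
  ∑' m : ℕ, (m.choose k : ℝ) * a ^ (m - k) * b ^ k * s ^ (2 * m + 1) /
    ((2 * m + 1).factorial : ℝ)

theorem abs_choose_mul_pow_le (a b : ℝ) (k m : ℕ) :
    |(m.choose k : ℝ) * a ^ (m - k) * b ^ k| ≤ (|a| + |b|) ^ m := by
  rcases lt_or_ge m k with h | h
  · rw [Nat.choose_eq_zero_of_lt h]
    simp only [Nat.cast_zero, zero_mul, abs_zero]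
    positivity
  · rw [add_comm, add_pow, abs_mul, abs_mul, abs_pow, abs_pow, Nat.abs_cast]
    have := Finset.single_le_sum (f := fun i => |b| ^ i * |a| ^ (m - i) * (m.choose i : ℝ))
      (fun i _ => by positivity) (Finset.mem_range.2 (Nat.lt_succ_of_le h))
    refine le_trans (le_of_eq ?_) this
    ring

theorem summable_cosKernel (a b : ℝ) (k : ℕ) (s : ℝ) :
    Summable fun m : ℕ =>
      (m.choose k : ℝ) * a ^ (m - k) * b ^ k * s ^ (2 * m) / ((2 * m).factorial : ℝ) := by
  refine Summable.of_norm_bounded (Real.summable_pow_div_factorial ((|a| + |b|) * s ^ 2))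
    fun m => ?_
  rw [Real.norm_eq_abs, abs_div, abs_mul, Nat.abs_cast, mul_pow, pow_mul, abs_pow, abs_pow, sq_abs]
  have hfac : (m.factorial : ℝ) ≤ ((2 * m).factorial : ℝ) := by
    exact_mod_cast Nat.factorial_le (by omega)
  gcongr
  exact abs_choose_mul_pow_le a b k m

theorem summable_sinKernel (a b : ℝ) (k : ℕ) (s : ℝ) :
    Summable fun m : ℕ =>
      (m.choose k : ℝ) * a ^ (m - k) * b ^ k * s ^ (2 * m + 1) /
        ((2 * m + 1).factorial : ℝ) := by
  refine Summable.of_norm_bounded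
    ((Real.summable_pow_div_factorial ((|a| + |b|) * s ^ 2)).mul_right |s|) fun m => ?_
  rw [Real.norm_eq_abs, abs_div, abs_mul, Nat.abs_cast, mul_pow, pow_succ s, pow_mul s,
    abs_mul ((s ^ 2) ^ m), abs_pow, abs_pow, sq_abs, div_mul_eq_mul_div, ← mul_assoc]
  have hfac : (m.factorial : ℝ) ≤ ((2 * m + 1).factorial : ℝ) := by
    exact_mod_cast Nat.factorial_le (by omega)
  gcongr
  exact abs_choose_mul_pow_le a b k m

theorem cosKernel_zero (w b s : ℝ) : cosKernel (-w ^ 2) b 0 s = Real.cos (w * s) := by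
  rw [cosKernel, Real.cos_eq_tsum]
  congr 1
  ext m
  rw [neg_pow, Nat.choose_zero_right, mul_pow, pow_mul w]
  simp
  ring

theorem sinKernel_zero {w : ℝ} (hw : w ≠ 0) (b s : ℝ) :
    sinKernel (-w ^ 2) b 0 s = Real.sin (w * s) / w := by
  rw [sinKernel, Real.sin_eq_tsum, ← tsum_div_const]
  congr 1
  ext m
  rw [neg_pow, Nat.choose_zero_right, mul_pow, pow_succ w (2 * m), pow_mul w]
  simp
  field_simp

theorem cosKernel_succ (a b : ℝ) (k : ℕ) (s : ℝ) :
    cosKernel a b (k + 1) s = b * s / (2 * (k + 1)) * sinKernel a b k s := by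
  rw [cosKernel, (summable_cosKernel a b (k + 1) s).tsum_eq_zero_add, sinKernel, ← tsum_mul_left]
  simp only [Nat.choose_zero_succ, Nat.cast_zero, zero_mul, zero_div, zero_add]
  congr 1
  ext m
  have h : ((m : ℝ) + 1) * (m.choose k : ℝ) = ((m + 1).choose (k + 1) : ℝ) * (k + 1) := by
    exact_mod_cast Nat.add_one_mul_choose_eq m k
  have hk : (k : ℝ) + 1 ≠ 0 := by positivity
  have hm : ((2 * m + 1).factorial : ℝ) ≠ 0 := by positivity
  have hfac : ((2 * (m + 1)).factorial : ℝ) = 2 * (m + 1) * ((2 * m + 1).factorial : ℝ) := by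
    rw [show 2 * (m + 1) = (2 * m + 1) + 1 by ring, Nat.factorial_succ]
    push_cast
    ring
  rw [hfac, Nat.add_sub_add_right, div_mul_div_comm, div_eq_div_iff (by positivity) (by positivity)]
  linear_combination (-2 * a ^ (m - k) * b ^ (k + 1) * s ^ (2 * m + 2) *
    ((2 * m + 1).factorial : ℝ)) * h

theorem mul_sinKernel_succ (a b : ℝ) (k : ℕ) (s : ℝ) :
    2 * (k + 1) * a * sinKernel a b (k + 1) s =
      b * (s * cosKernel a b k s - (2 * k + 1) * sinKernel a b k s) := by
  rw [sinKernel, sinKernel, cosKernel, ← tsum_mul_left, ← tsum_mul_left, ← tsum_mul_left,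
    ← ((summable_cosKernel a b k s).mul_left s).tsum_sub
      ((summable_sinKernel a b k s).mul_left (2 * (k : ℝ) + 1)), ← tsum_mul_left]
  congr 1
  ext m
  have hfac : ((2 * m + 1).factorial : ℝ) = (2 * m + 1) * ((2 * m).factorial : ℝ) := by
    rw [Nat.factorial_succ]
    push_cast
    ring
  rcases lt_trichotomy m k with h | rfl | h
  · simp [Nat.choose_eq_zero_of_lt h, Nat.choose_eq_zero_of_lt (Nat.lt_succ_of_lt h)]
  · simp only [Nat.choose_succ_self, Nat.choose_self, hfac]
    have h2 : 2 * (m : ℝ) + 1 ≠ 0 := by positivity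
    field_simp
    push_cast
    ring
  · have hc : ((m.choose (k + 1) : ℕ) : ℝ) * (k + 1) = (m.choose k : ℝ) * (m - k) := by
      rw [← Nat.cast_sub h.le]
      exact_mod_cast Nat.choose_succ_right_eq m k
    have ha : a ^ (m - k) = a * a ^ (m - (k + 1)) := by
      rw [← pow_succ', show m - (k + 1) + 1 = m - k by omega]
    have h2 : 2 * (m : ℝ) + 1 ≠ 0 := by positivity
    rw [hfac, ha]
    field_simp
    linear_combination (2 * s * b ^ (k + 1) * s ^ (2 * m) * a * a ^ (m - (k + 1))) * hc

theorem sinKernel_succ {a : ℝ} (ha : a ≠ 0) (b : ℝ) (k : ℕ) (s : ℝ) :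
    sinKernel a b (k + 1) s =
      b / (2 * (k + 1) * a) * (s * cosKernel a b k s - (2 * k + 1) * sinKernel a b k s) := by
  have hk : (k : ℝ) + 1 ≠ 0 := by positivity
  rw [div_mul_eq_mul_div, ← mul_sinKernel_succ, mul_div_cancel_left₀ _ (by positivity)]

theorem cosKernel_apply_zero (a b : ℝ) {k : ℕ} (hk : k ≠ 0) : cosKernel a b k 0 = 0 := by
  obtain ⟨k, rfl⟩ := Nat.exists_eq_succ_of_ne_zero hk
  simp [cosKernel_succ]

theorem sinKernel_apply_zero (a b : ℝ) (k : ℕ) : sinKernel a b k 0 = 0 := by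
  simp [sinKernel]

theorem continuous_kernels {w : ℝ} (hw : 0 < w) (b : ℝ) (k : ℕ) :
    Continuous (cosKernel (-w ^ 2) b k) ∧ Continuous (sinKernel (-w ^ 2) b k) := by
  induction k with
  | zero =>
    rw [funext (cosKernel_zero w b), funext (sinKernel_zero hw.ne' b)]
    constructor <;> fun_prop
  | succ k ih =>
    obtain ⟨hc, hs⟩ := ih
    have ha : -w ^ 2 ≠ 0 := by simp [hw.ne']
    rw [funext (cosKernel_succ (-w ^ 2) b k), funext (sinKernel_succ ha b k)]
    constructor <;> fun_prop

theorem abs_kernels_le {w W T s : ℝ} (hw : 0 < w) (hW : 1 / w ≤ W) (b : ℝ) (hs : 0 ≤ s)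
    (hsT : s ≤ T) (k : ℕ) :
    |cosKernel (-w ^ 2) b k s| ≤ ((W + T) * |b| / w) ^ k ∧
      |sinKernel (-w ^ 2) b k s| ≤ ((W + T) * |b| / w) ^ k / w := by
  induction k with
  | zero =>
    rw [cosKernel_zero, sinKernel_zero hw.ne', abs_div, abs_of_pos hw]
    refine ⟨by simpa using Real.abs_cos_le_one _, ?_⟩
    gcongr
    simpa using Real.abs_sin_le_one _
  | succ k ih =>
    obtain ⟨hc, hs'⟩ := ih
    have hW0 : 0 ≤ W := le_trans (by positivity) hW
    have hT0 : 0 ≤ T := hs.trans hsT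
    have hk : (0 : ℝ) ≤ k := k.cast_nonneg
    set R := (W + T) * |b| / w with hR
    have hR0 : 0 ≤ R := by positivity
    constructor
    · rw [cosKernel_succ, abs_mul, abs_div, abs_mul, abs_of_nonneg hs,
        abs_of_nonneg (by positivity : (0 : ℝ) ≤ 2 * (k + 1))]
      calc |b| * s / (2 * (k + 1)) * |sinKernel (-w ^ 2) b k s|
          ≤ |b| * (W + T) / 1 * (R ^ k / w) := by
            gcongr
            · linarith
            · linarith
        _ = R ^ (k + 1) := by
            rw [pow_succ, hR]
            ring
    · have ha : -w ^ 2 ≠ 0 := by simp [hw.ne']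
      rw [sinKernel_succ ha, abs_mul, abs_div, abs_mul, abs_neg, abs_pow, abs_of_pos hw,
        abs_of_nonneg (by positivity : (0 : ℝ) ≤ 2 * (k + 1))]
      have h1 : |s * cosKernel (-w ^ 2) b k s - (2 * k + 1) * sinKernel (-w ^ 2) b k s| ≤
          2 * (k + 1) * (W + T) * R ^ k := by
        calc _ ≤ |s * cosKernel (-w ^ 2) b k s| + |(2 * k + 1) * sinKernel (-w ^ 2) b k s| :=
              abs_sub _ _
          _ = s * |cosKernel (-w ^ 2) b k s| + (2 * k + 1) * |sinKernel (-w ^ 2) b k s| := by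
              rw [abs_mul, abs_mul, abs_of_nonneg hs,
                abs_of_nonneg (by positivity : (0 : ℝ) ≤ 2 * k + 1)]
          _ ≤ T * R ^ k + (2 * k + 1) * (R ^ k / w) := by gcongr
          _ = T * R ^ k + (2 * k + 1) * (1 / w) * R ^ k := by ring
          _ ≤ (2 * (k + 1) * T) * R ^ k + (2 * (k + 1)) * W * R ^ k := by
              gcongr
              · nlinarith
              · linarith
          _ = _ := by ring
      calc _ ≤ |b| / (2 * (k + 1) * w ^ 2) * (2 * (k + 1) * (W + T) * R ^ k) := by gcongr
        _ = (W + T) * |b| * R ^ k / w ^ 2 := by field_simp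
        _ = R * w * R ^ k / w ^ 2 := by rw [hR, div_mul_cancel₀ _ hw.ne']
        _ = R ^ (k + 1) / w := by
            field_simp
            ring

theorem Cdel_eq_sum {τ a b t : ℝ} {N : ℕ} (hτ : 0 < τ) (ht0 : 0 ≤ t) (ht : t ≤ N * τ) :
    Cdel τ a b t = ∑ k ∈ Finset.range (N + 1), cosKernel a b k (max (t - k * τ) 0) := by
  have hterm : ∀ k, ∑' m, Cterm τ a b t k m = cosKernel a b k (max (t - k * τ) 0) := by
    intro k
    rw [cosKernel]
    congr 1
    ext m
    rw [Cterm]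
    split_ifs with h
    · rfl
    · simp [Nat.choose_eq_zero_of_lt (not_le.1 h)]
  rw [Cdel, if_neg ht0.not_gt]
  simp_rw [hterm]
  refine tsum_eq_sum fun k hk => ?_
  rw [Finset.mem_range, not_lt] at hk
  have hNk : (N : ℝ) ≤ k := by exact_mod_cast (Nat.le_succ N).trans hk
  rw [max_eq_right (by nlinarith), cosKernel_apply_zero _ _ (by omega)]

theorem Sdel_eq_sum {τ a b t : ℝ} {N : ℕ} (hτ : 0 < τ) (ht : t ≤ N * τ) :
    Sdel τ a b t = ∑ k ∈ Finset.range N, sinKernel a b k (max (t - k * τ) 0) := by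
  have hterm : ∀ k, ∑' m, Sterm τ a b t k m = sinKernel a b k (max (t - k * τ) 0) := by
    intro k
    rw [sinKernel]
    congr 1
    ext m
    rw [Sterm]
    split_ifs with h
    · rfl
    · simp [Nat.choose_eq_zero_of_lt (not_le.1 h)]
  rw [Sdel]
  split_ifs with ht0
  · refine (Finset.sum_eq_zero fun k _ => ?_).symm
    have hk : (0 : ℝ) ≤ k := k.cast_nonneg
    rw [max_eq_right (by nlinarith), sinKernel_apply_zero]
  · simp_rw [hterm]
    refine tsum_eq_sum fun k hk => ?_
    rw [Finset.mem_range, not_lt] at hk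
    have hNk : (N : ℝ) ≤ k := by exact_mod_cast hk
    rw [max_eq_right (by nlinarith), sinKernel_apply_zero]

theorem continuousOn_Cdel {τ w b : ℝ} (N : ℕ) (hτ : 0 < τ) (hw : 0 < w) :
    ContinuousOn (Cdel τ (-w ^ 2) b) (Set.Icc 0 (N * τ)) := by
  refine ContinuousOn.congr (Continuous.continuousOn ?_) fun t ht => Cdel_eq_sum hτ ht.1 ht.2
  exact continuous_finsetSum _ fun k _ => (continuous_kernels hw b k).1.comp (by fun_prop)

theorem continuous_Sdel {τ w b : ℝ} (hτ : 0 < τ) (hw : 0 < w) :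
    Continuous (Sdel τ (-w ^ 2) b) := by
  rw [continuous_iff_continuousAt]
  intro t
  obtain ⟨N, hN⟩ := exists_nat_gt (t / τ)
  have hN : t < N * τ := (div_lt_iff₀ hτ).1 hN
  refine ContinuousAt.congr (f := fun t => ∑ k ∈ Finset.range N,
    sinKernel (-w ^ 2) b k (max (t - k * τ) 0)) (Continuous.continuousAt ?_) ?_
  · exact continuous_finsetSum _ fun k _ => (continuous_kernels hw b k).2.comp (by fun_prop)
  · filter_upwards [Iio_mem_nhds hN] with s hs using (Sdel_eq_sum hτ (Set.mem_Iio.1 hs).le).symm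

/-- If `w` grows at least like `x` and `b` at most like `x ^ 2`, then on `[0, N τ]` the function
`Cdel` grows at most like `x ^ N` and `Sdel` at most like `x ^ (N - 2)`. -/
theorem abs_Cdel_Sdel_le {τ c D : ℝ} (N : ℕ) (hτ : 0 < τ) (hc : 0 < c) (hD : 0 ≤ D) :
    ∃ M : ℝ, 0 ≤ M ∧ ∀ w b x : ℝ, 1 ≤ x → c * x ≤ w → |b| ≤ D * x ^ 2 →
      (∀ t ∈ Set.Icc 0 (N * τ), |Cdel τ (-w ^ 2) b t| ≤ M * x ^ N) ∧
      ∀ t ≤ N * τ, |Sdel τ (-w ^ 2) b t| * x ^ 2 ≤ M * x ^ N := by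
  have hT : 0 ≤ N * τ := by positivity
  set Q := max 1 ((1 / c + N * τ) * D / c)
  have hQ : 1 ≤ Q := le_max_left _ _
  have hQ0 : 0 ≤ Q := zero_le_one.trans hQ
  refine ⟨(N + 1) * Q ^ N + N * Q ^ N / c, by positivity, fun w b x hx hw hb => ?_⟩
  have hx0 : 0 < x := by linarith
  have hw0 : 0 < w := lt_of_lt_of_le (by positivity) hw
  have hcw : c ≤ w := le_trans (by nlinarith) hw
  have hR : (1 / c + N * τ) * |b| / w ≤ Q * x :=
    calc _ ≤ (1 / c + N * τ) * (D * x ^ 2) / (c * x) := by gcongr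
      _ = (1 / c + N * τ) * D / c * x := by field_simp
      _ ≤ Q * x := by
        gcongr
        exact le_max_right _ _
  have hQx : 1 ≤ Q * x := by nlinarith
  have hmax : ∀ (t : ℝ) (k : ℕ), t ≤ N * τ → max (t - k * τ) 0 ≤ N * τ := fun t k ht =>
    max_le (by nlinarith [(k.cast_nonneg : (0 : ℝ) ≤ k)]) hT
  have hker := fun (t : ℝ) (k : ℕ) (ht : t ≤ N * τ) =>
    abs_kernels_le hw0 (one_div_le_one_div_of_le hc hcw) b (le_max_right (t - k * τ) 0)
      (hmax t k ht) k
  constructor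
  · intro t ht
    rw [Cdel_eq_sum hτ ht.1 ht.2]
    calc _ ≤ ∑ k ∈ Finset.range (N + 1), |cosKernel (-w ^ 2) b k (max (t - k * τ) 0)| :=
          Finset.abs_sum_le_sum_abs _ _
      _ ≤ ∑ k ∈ Finset.range (N + 1), (Q * x) ^ N := by
          refine Finset.sum_le_sum fun k hk => (hker t k ht.2).1.trans ?_
          exact (pow_le_pow_left₀ (by positivity) hR k).trans
            (pow_le_pow_right₀ hQx (Nat.lt_succ_iff.1 (Finset.mem_range.1 hk)))
      _ = (N + 1) * Q ^ N * x ^ N := by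
          rw [Finset.sum_const, Finset.card_range, nsmul_eq_mul, mul_pow]
          push_cast
          ring
      _ ≤ _ := by
          gcongr
          exact le_add_of_nonneg_right (by positivity)
  · intro t ht
    rw [Sdel_eq_sum hτ ht]
    calc _ ≤ (∑ k ∈ Finset.range N, |sinKernel (-w ^ 2) b k (max (t - k * τ) 0)|) * x ^ 2 := by
          gcongr
          exact Finset.abs_sum_le_sum_abs _ _
      _ ≤ (∑ k ∈ Finset.range N, (Q * x) ^ N / (c * x ^ 2)) * x ^ 2 := by
          gcongr with k hk
          calc _ ≤ ((1 / c + N * τ) * |b| / w) ^ k / w := (hker t k ht).2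
            _ ≤ (Q * x) ^ k / (c * x) := by gcongr
            _ = (Q * x) ^ k * x / (c * x ^ 2) := by field_simp
            _ ≤ (Q * x) ^ k * (Q * x) / (c * x ^ 2) := by
                gcongr
                exact le_mul_of_one_le_left hx0.le hQ
            _ ≤ (Q * x) ^ N / (c * x ^ 2) := by
                rw [← pow_succ]
                gcongr
                · exact Finset.mem_range.1 hk
      _ = N * Q ^ N / c * x ^ N := by
          rw [Finset.sum_const, Finset.card_range, nsmul_eq_mul, mul_pow]
          field_simp
      _ ≤ _ := by
          gcongr
          exact le_add_of_nonneg_left (by positivity)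

theorem abs_le_biSup_Icc {f : ℝ → ℝ} {a b s : ℝ} (hf : ContinuousOn f (Set.Icc a b))
    (hs : s ∈ Set.Icc a b) : |f s| ≤ ⨆ r ∈ Set.Icc a b, |f r| := by
  obtain ⟨M, hM⟩ := isCompact_Icc.exists_bound_of_continuousOn hf
  have hbdd : BddAbove (Set.range fun r => ⨆ _ : r ∈ Set.Icc a b, |f r|) := by
    refine ⟨max M 0, ?_⟩
    rintro _ ⟨r, rfl⟩
    exact Real.iSup_le (fun hr => (hM r hr).trans (le_max_left _ _)) (le_max_right _ _)
  refine le_ciSup_of_le hbdd s ?_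
  rw [ciSup_pos hs]

theorem continuousOn_integral_mul {k : ℝ → ℝ → ℝ} {f g : ℝ → ℝ} {a b : ℝ} {X : Set ℝ}
    (hab : a ≤ b) (hk : Continuous (Function.uncurry k)) (hf : ContinuousOn f (Set.Icc a b))
    (hg : Continuous g) (hgX : ∀ t ∈ X, g t ∈ Set.Icc a b) :
    ContinuousOn (fun t => ∫ s in a..g t, k t s * f s) X := by
  have hf' : Continuous (Set.IccExtend hab (Set.domRestrict (Set.Icc a b) f)) :=
    (continuousOn_iff_continuous_domRestrict.1 hf).Icc_extend'
  have hcont : Continuous fun t =>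
      ∫ s in a..g t, k t s * Set.IccExtend hab (Set.domRestrict (Set.Icc a b) f) s := by
    refine intervalIntegral.continuous_parametric_intervalIntegral_of_continuous
      (f := fun t s => k t s * Set.IccExtend hab (Set.domRestrict (Set.Icc a b) f) s) ?_ hg
    exact hk.mul (hf'.comp continuous_snd)
  refine hcont.continuousOn.congr fun t ht => intervalIntegral.integral_congr fun s hs => ?_
  rw [Set.uIcc_of_le (hgX t ht).1] at hs
  simp only [Set.IccExtend_of_mem hab _ ⟨hs.1, hs.2.trans (hgX t ht).2⟩]
  rfl

/-- A sine series whose coefficients, multiplied by the squared frequencies, are uniformly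
dominated by a summable sequence may be differentiated twice term by term. -/
theorem sine_series_twice_differentiable {L : ℝ} (hL : 0 < L) {c : ℕ → ℝ → ℝ} {X : Set ℝ}
    {u : ℕ → ℝ} (hu : Summable u) (hc : ∀ n, ContinuousOn (c n) X)
    (hcu : ∀ n : ℕ, ∀ t ∈ X, (((n : ℝ) + 1) * Real.pi / L) ^ 2 * |c n t| ≤ u n)
    {v : ℝ → ℝ → ℝ}
    (hv : ∀ t x, v t x = ∑' n : ℕ, c n t * Real.sin (((n : ℝ) + 1) * Real.pi * x / L))
    (Y : Set ℝ) :
    (∀ p : ℝ × ℝ, p ∈ X ×ˢ Y →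
      Summable (fun n : ℕ => |(((n : ℝ) + 1) * Real.pi / L) ^ 2 * c n p.1
          * Real.sin (((n : ℝ) + 1) * Real.pi * p.2 / L)|)) ∧
    TendstoUniformlyOn
      (fun (m : ℕ) (p : ℝ × ℝ) => ∑ n ∈ Finset.range m,
        (((n : ℝ) + 1) * Real.pi / L) ^ 2 * c n p.1
          * Real.sin (((n : ℝ) + 1) * Real.pi * p.2 / L))
      (fun p : ℝ × ℝ => ∑' n : ℕ, (((n : ℝ) + 1) * Real.pi / L) ^ 2 * c n p.1
          * Real.sin (((n : ℝ) + 1) * Real.pi * p.2 / L))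
      Filter.atTop (X ×ˢ Y) ∧
    (∀ t ∈ X, ∀ x ∈ Y,
      HasDerivAt (fun ξ => v t ξ) (deriv (fun ξ => v t ξ) x) x ∧
      HasDerivAt (deriv (fun ξ => v t ξ))
        (∑' n : ℕ, -((((n : ℝ) + 1) * Real.pi / L) ^ 2 * c n t
          * Real.sin (((n : ℝ) + 1) * Real.pi * x / L))) x) ∧
    ContinuousOn (fun p : ℝ × ℝ => deriv (deriv (fun ξ => v p.1 ξ)) p.2) (X ×ˢ Y) := by
  have hbound : ∀ (n : ℕ), ∀ t ∈ X, ∀ x : ℝ,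
      |(((n : ℝ) + 1) * Real.pi / L) ^ 2 * c n t
        * Real.sin (((n : ℝ) + 1) * Real.pi * x / L)| ≤ u n := by
    intro n t ht x
    rw [abs_mul, abs_mul, abs_pow, sq_abs]
    exact (mul_le_of_le_one_right (by positivity) (Real.abs_sin_le_one _)).trans (hcu n t ht)
  have hκ : 0 < Real.pi / L := div_pos Real.pi_pos hL
  have hκn : ∀ n : ℕ, Real.pi / L ≤ ((n : ℝ) + 1) * Real.pi / L := fun n => by
    rw [mul_div_assoc]
    exact le_mul_of_one_le_left hκ.le (by simp)
  have hd1 : ∀ t ∈ X, ∀ x, HasDerivAt (fun ξ => v t ξ)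
      (∑' n : ℕ, ((n : ℝ) + 1) * Real.pi / L * c n t
        * Real.cos (((n : ℝ) + 1) * Real.pi * x / L)) x := by
    intro t ht x
    rw [funext (hv t)]
    refine hasDerivAt_tsum (hu.div_const (Real.pi / L))
      (g := fun (n : ℕ) ξ => c n t * Real.sin (((n : ℝ) + 1) * Real.pi * ξ / L))
      (g' := fun (n : ℕ) ξ => ((n : ℝ) + 1) * Real.pi / L * c n t
        * Real.cos (((n : ℝ) + 1) * Real.pi * ξ / L)) (y₀ := 0) (fun n y => ?_) (fun n y => ?_)
      (by simp) x
    · have h := ((((hasDerivAt_id y).const_mul (((n : ℝ) + 1) * Real.pi)).div_const L).sin).const_mul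
        (c n t)
      refine h.congr_deriv ?_
      simp only [id]
      ring
    · rw [Real.norm_eq_abs, abs_mul, abs_mul, abs_of_pos (hκ.trans_le (hκn n)), le_div_iff₀ hκ]
      refine le_trans ?_ (hcu n t ht)
      calc _ ≤ ((n : ℝ) + 1) * Real.pi / L * |c n t| * 1 * (((n : ℝ) + 1) * Real.pi / L) := by
            have := hκn n
            gcongr
            exact Real.abs_cos_le_one _
        _ = _ := by ring
  have hderiv : ∀ t ∈ X, deriv (fun ξ => v t ξ) = fun x =>
      ∑' n : ℕ, ((n : ℝ) + 1) * Real.pi / L * c n t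
        * Real.cos (((n : ℝ) + 1) * Real.pi * x / L) := fun t ht =>
    funext fun x => (hd1 t ht x).deriv
  have hd2 : ∀ t ∈ X, ∀ x, HasDerivAt (deriv (fun ξ => v t ξ))
      (∑' n : ℕ, -((((n : ℝ) + 1) * Real.pi / L) ^ 2 * c n t
          * Real.sin (((n : ℝ) + 1) * Real.pi * x / L))) x := by
    intro t ht x
    rw [hderiv t ht]
    refine hasDerivAt_tsum hu
      (g := fun (n : ℕ) ξ => ((n : ℝ) + 1) * Real.pi / L * c n t
        * Real.cos (((n : ℝ) + 1) * Real.pi * ξ / L))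
      (g' := fun (n : ℕ) ξ => -((((n : ℝ) + 1) * Real.pi / L) ^ 2 * c n t
        * Real.sin (((n : ℝ) + 1) * Real.pi * ξ / L)))
      (y₀ := 0) (fun n y => ?_)
      (fun n y => by simpa only [norm_neg, Real.norm_eq_abs] using hbound n t ht y) ?_ x
    · have h := ((((hasDerivAt_id y).const_mul (((n : ℝ) + 1) * Real.pi)).div_const L).cos).const_mul
        (((n : ℝ) + 1) * Real.pi / L * c n t)
      refine h.congr_deriv ?_
      simp only [id]
      ring
    · refine Summable.of_norm_bounded (hu.div_const (Real.pi / L)) fun n => ?_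
      rw [Real.norm_eq_abs, abs_mul, abs_mul, abs_of_pos (hκ.trans_le (hκn n)), le_div_iff₀ hκ]
      refine le_trans ?_ (hcu n t ht)
      calc _ ≤ ((n : ℝ) + 1) * Real.pi / L * |c n t| * 1 * (((n : ℝ) + 1) * Real.pi / L) := by
            have := hκn n
            gcongr
            exact Real.abs_cos_le_one _
        _ = _ := by ring
  refine ⟨fun p hp => Summable.of_nonneg_of_le (fun n => abs_nonneg _)
      (fun n => hbound n p.1 hp.1 p.2) hu,
    tendstoUniformlyOn_tsum_nat hu fun n p hp => hbound n p.1 hp.1 p.2,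
    fun t ht x _ => ⟨(hd1 t ht x).differentiableAt.hasDerivAt, hd2 t ht x⟩, ?_⟩
  refine ContinuousOn.congr (continuousOn_tsum (fun n => ?_) hu fun n p hp => ?_)
    fun p hp => (hd2 p.1 hp.1 p.2).deriv
  · have hcn : ContinuousOn (fun p : ℝ × ℝ => c n p.1) (X ×ˢ Y) :=
      (hc n).comp continuousOn_fst fun p hp => hp.1
    exact ((continuousOn_const.mul hcn).mul (by fun_prop)).neg
  · rw [norm_neg]
    exact hbound n p.1 hp.1 p.2

theorem exists_mul_le_sqrt_sq_sub {p d : ℝ} (hp : 0 < p) (h : 0 < p ^ 2 - d) :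
    ∃ c : ℝ, 0 < c ∧ ∀ x : ℝ, 1 ≤ x → c * x ≤ Real.sqrt ((x * p) ^ 2 - d) := by
  have hmin : 0 < min (p ^ 2) (p ^ 2 - d) := lt_min (by positivity) h
  refine ⟨Real.sqrt (min (p ^ 2) (p ^ 2 - d)), Real.sqrt_pos.2 hmin, fun x hx => ?_⟩
  refine Real.le_sqrt_of_sq_le ?_
  rw [mul_pow, Real.sq_sqrt hmin.le]
  have hx2 : 1 ≤ x ^ 2 := one_le_pow₀ hx
  rcases le_total d 0 with hd | hd
  · nlinarith [min_le_left (p ^ 2) (p ^ 2 - d)]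
  · nlinarith [min_le_right (p ^ 2) (p ^ 2 - d)]

theorem sq_sqrt_sq_sub_le {p d x : ℝ} (hx : 1 ≤ x) (h : 0 ≤ (x * p) ^ 2 - d) :
    Real.sqrt ((x * p) ^ 2 - d) ^ 2 ≤ (p ^ 2 + |d|) * x ^ 2 := by
  rw [Real.sq_sqrt h]
  nlinarith [neg_abs_le d, abs_nonneg d, one_le_pow₀ hx (n := 2)]

theorem continuousOn_fourier_coefficient {τ T w b : ℝ} {N : ℕ} (hτ : 0 < τ) (hT : T = N * τ)
    (hw : 0 < w) {φ f : ℝ → ℝ} (hφ : ContinuousOn φ (Set.Icc (-τ) 0))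
    (hf : ContinuousOn f (Set.Icc 0 T)) (y z : ℝ) :
    ContinuousOn (fun t => Cdel τ (-w ^ 2) b t * y + Sdel τ (-w ^ 2) b t * z
      + b * (∫ s in (-τ)..(0 : ℝ), Sdel τ (-w ^ 2) b (t - τ - s) * φ s)
      + ∫ s in (0 : ℝ)..t, Sdel τ (-w ^ 2) b (t - s) * f s) (Set.Icc 0 T) := by
  have hS : Continuous (Sdel τ (-w ^ 2) b) := continuous_Sdel hτ hw
  have hT0 : 0 ≤ T := by rw [hT]; positivity
  refine ContinuousOn.add (ContinuousOn.add ?_ (continuousOn_const.mul ?_)) ?_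
  · refine ContinuousOn.add (ContinuousOn.mul ?_ continuousOn_const)
      (hS.continuousOn.mul continuousOn_const)
    rw [hT]
    exact continuousOn_Cdel N hτ hw
  · exact continuousOn_integral_mul (k := fun t s => Sdel τ (-w ^ 2) b (t - τ - s))
      (g := fun _ => 0) (by linarith) (hS.comp (by fun_prop)) hφ continuous_const
      fun _ _ => ⟨by linarith, le_rfl⟩
  · exact continuousOn_integral_mul (k := fun t s => Sdel τ (-w ^ 2) b (t - s))
      (g := fun t => t) hT0 (hS.comp (by fun_prop)) hf continuous_id fun _ ht => ht

theorem abs_fourier_coefficient_le {τ T t a b x M D φ₀ φ₁ f₀ : ℝ} {N : ℕ} (hτ : 0 < τ)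
    (ht : t ∈ Set.Icc 0 T) (hx : 1 ≤ x) (hM : 0 ≤ M)
    (hb : |b| ≤ D * x ^ 2)
    (hCd : |Cdel τ a b t| ≤ M * x ^ N)
    (hSd : ∀ t ≤ T, |Sdel τ a b t| * x ^ 2 ≤ M * x ^ N)
    {φ f : ℝ → ℝ} (hφ : ∀ s ∈ Set.Icc (-τ) 0, |φ s| ≤ φ₁) (hf : ∀ s ∈ Set.Icc 0 T, |f s| ≤ f₀)
    {y z : ℝ} (hyz : |y| + |z| ≤ φ₀) :
    x ^ 2 * |Cdel τ a b t * y + Sdel τ a b t * z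
      + b * (∫ s in (-τ)..(0 : ℝ), Sdel τ a b (t - τ - s) * φ s)
      + ∫ s in (0 : ℝ)..t, Sdel τ a b (t - s) * f s| ≤
    M * (φ₀ * (x ^ N * x ^ 2)) + D * τ * M * (φ₁ * (x ^ N * x ^ 2))
      + T * M * (f₀ * (x ^ N * x)) := by
  have hx0 : 0 < x := by linarith
  have hT0 : 0 ≤ T := ht.1.trans ht.2
  have hφ₁ : 0 ≤ φ₁ := (abs_nonneg _).trans (hφ 0 ⟨by linarith, le_rfl⟩)
  have hf₀ : 0 ≤ f₀ := (abs_nonneg _).trans (hf 0 ⟨le_rfl, hT0⟩)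
  have hSd' : ∀ t ≤ T, |Sdel τ a b t| ≤ M * x ^ N / x ^ 2 := fun t ht =>
    (le_div_iff₀ (by positivity)).2 (hSd t ht)
  have hA : x ^ 2 * |Cdel τ a b t * y + Sdel τ a b t * z| ≤ M * (φ₀ * (x ^ N * x ^ 2)) := by
    calc _ ≤ x ^ 2 * (|Cdel τ a b t| * |y| + |Sdel τ a b t| * |z|) := by
          rw [← abs_mul, ← abs_mul]
          gcongr
          exact abs_add_le _ _
      _ = |Cdel τ a b t| * |y| * x ^ 2 + |Sdel τ a b t| * x ^ 2 * 1 * |z| := by ring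
      _ ≤ M * x ^ N * |y| * x ^ 2 + M * x ^ N * x ^ 2 * |z| := by
          have hx2 : 1 ≤ x ^ 2 := one_le_pow₀ hx
          gcongr ?_ * _ * _ + ?_ * ?_ * _
          · exact hSd t ht.2
      _ = M * ((|y| + |z|) * (x ^ N * x ^ 2)) := by ring
      _ ≤ _ := by gcongr
  have hB : |∫ s in (-τ)..(0 : ℝ), Sdel τ a b (t - τ - s) * φ s| ≤
      M * x ^ N / x ^ 2 * φ₁ * τ := by
    have := intervalIntegral.norm_integral_le_of_norm_le_const (a := -τ) (b := 0)
      (f := fun s => Sdel τ a b (t - τ - s) * φ s) (C := M * x ^ N / x ^ 2 * φ₁) fun s hs => by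
        rw [Set.uIoc_of_le (by linarith)] at hs
        rw [Real.norm_eq_abs, abs_mul]
        gcongr
        · exact hSd' _ (by linarith [hs.1, ht.2])
        · exact hφ s ⟨hs.1.le, hs.2⟩
    simpa [abs_of_pos hτ] using this
  have hC : |∫ s in (0 : ℝ)..t, Sdel τ a b (t - s) * f s| ≤ M * x ^ N / x ^ 2 * f₀ * T := by
    have := intervalIntegral.norm_integral_le_of_norm_le_const (a := 0) (b := t)
      (f := fun s => Sdel τ a b (t - s) * f s) (C := M * x ^ N / x ^ 2 * f₀) fun s hs => by
        rw [Set.uIoc_of_le ht.1] at hs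
        rw [Real.norm_eq_abs, abs_mul]
        gcongr
        · exact hSd' _ (by linarith [hs.1, ht.2])
        · exact hf s ⟨hs.1.le, hs.2.trans ht.2⟩
    refine this.trans ?_
    rw [sub_zero, abs_of_nonneg ht.1]
    gcongr
    exact ht.2
  calc _ ≤ x ^ 2 * (|Cdel τ a b t * y + Sdel τ a b t * z|
          + |b| * |∫ s in (-τ)..(0 : ℝ), Sdel τ a b (t - τ - s) * φ s|
          + |∫ s in (0 : ℝ)..t, Sdel τ a b (t - s) * f s|) := by
        rw [← abs_mul]
        gcongr
        exact abs_add_three _ _ _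
    _ = x ^ 2 * |Cdel τ a b t * y + Sdel τ a b t * z|
          + x ^ 2 * (|b| * |∫ s in (-τ)..(0 : ℝ), Sdel τ a b (t - τ - s) * φ s|)
          + x ^ 2 * |∫ s in (0 : ℝ)..t, Sdel τ a b (t - s) * f s| := by ring
    _ ≤ M * (φ₀ * (x ^ N * x ^ 2)) + x ^ 2 * (D * x ^ 2 * (M * x ^ N / x ^ 2 * φ₁ * τ))
          + x ^ 2 * (M * x ^ N / x ^ 2 * f₀ * T) * x := by
        have hD : 0 ≤ D * x ^ 2 := (abs_nonneg _).trans hb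
        gcongr ?_ + ?_ + ?_
        · gcongr
        · refine le_trans ?_ (le_mul_of_one_le_right (by positivity) hx)
          gcongr
    _ = _ := by field_simp

/-- termwise spatial differentiation: under the same hypotheses as the
uniform-convergence theorem, the termwise twice-differentiated-in-`x` series
`Σₙ (nπ/L)²·(Aₙ(t)+Bₙ(t)+Cₙ(t))·sin(nπx/L)` also converges absolutely and uniformly on
`[0,T]×[0,L]`; in particular the sum `v(t,x) = Σₙ (Aₙ(t)+Bₙ(t)+Cₙ(t))·sin(nπx/L)` is
twice continuously differentiable in `x` and `∂ₓₓv` is obtained by termwise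
differentiation. -/
theorem fourier_series_termwise_spatial_differentiation (τ : ℝ) (hτ : 0 < τ) (N : ℕ)
    (T : ℝ) (hT : T = (N : ℝ) * τ) (K : ℕ) (hK : K = ⌈T / τ⌉₊)
    (L a₁ a₂ : ℝ) (hL : 0 < L) (ha₁ : 0 < a₁) (ha₂ : 0 < a₂) (d₁ d₂ : ℝ)
    (hpos₁ : ∀ n : ℕ, 0 < n → 0 < ((n : ℝ) * Real.pi * a₁ / L) ^ 2 - d₁)
    (hpos₂ : ∀ n : ℕ, 0 < n → 0 < ((n : ℝ) * Real.pi * a₂ / L) ^ 2 - d₂)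
    (ω υ : ℕ → ℝ)
    (hω : ∀ n : ℕ, ω n = Real.sqrt (((n : ℝ) * Real.pi * a₁ / L) ^ 2 - d₁))
    (hυ : ∀ n : ℕ, υ n = Real.sqrt (((n : ℝ) * Real.pi * a₂ / L) ^ 2 - d₂))
    (Φ F : ℕ → ℝ → ℝ)
    (hΦ : ∀ n : ℕ, ContDiffOn ℝ 1 (Φ n) (Set.Icc (-τ) 0))
    (hF : ∀ n : ℕ, ContinuousOn (F n) (Set.Icc (0 : ℝ) T))
    (α : ℝ) (hα : 0 < α)
    (hdecay₁ : Filter.Tendsto (fun n : ℕ =>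
      (|Φ n 0| + |derivWithin (Φ n) (Set.Icc (-τ) (0 : ℝ)) 0|)
        * (n : ℝ) ^ ((K : ℝ) + 3 + α)) Filter.atTop (nhds 0))
    (hdecay₂ : Filter.Tendsto (fun n : ℕ =>
      (⨆ s ∈ Set.Icc (-τ) (0 : ℝ), |Φ n s|) * (n : ℝ) ^ ((K : ℝ) + 3 + α))
      Filter.atTop (nhds 0))
    (hdecay₃ : Filter.Tendsto (fun n : ℕ =>
      (⨆ s ∈ Set.Icc (0 : ℝ) T, |F n s|) * (n : ℝ) ^ ((K : ℝ) + 2 + α))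
      Filter.atTop (nhds 0))
    (A B C : ℕ → ℝ → ℝ)
    (hA : ∀ n t, A n t = Cdel τ (-(ω n) ^ 2) (-(υ n) ^ 2) t * Φ n 0
      + Sdel τ (-(ω n) ^ 2) (-(υ n) ^ 2) t * derivWithin (Φ n) (Set.Icc (-τ) (0 : ℝ)) 0)
    (hB : ∀ n t, B n t = -(υ n) ^ 2 *
      ∫ s in (-τ)..(0 : ℝ), Sdel τ (-(ω n) ^ 2) (-(υ n) ^ 2) (t - τ - s) * Φ n s)
    (hC : ∀ n t, C n t = ∫ s in (0 : ℝ)..t, Sdel τ (-(ω n) ^ 2) (-(υ n) ^ 2) (t - s) * F n s)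
    (v : ℝ → ℝ → ℝ)
    (hv : ∀ t x, v t x = ∑' n : ℕ,
      (A (n + 1) t + B (n + 1) t + C (n + 1) t)
        * Real.sin (((n : ℝ) + 1) * Real.pi * x / L)) :
    (∀ p : ℝ × ℝ, p ∈ Set.Icc (0 : ℝ) T ×ˢ Set.Icc (0 : ℝ) L →
      Summable (fun n : ℕ =>
        |(((n : ℝ) + 1) * Real.pi / L) ^ 2 * (A (n + 1) p.1 + B (n + 1) p.1 + C (n + 1) p.1)
          * Real.sin (((n : ℝ) + 1) * Real.pi * p.2 / L)|)) ∧
    TendstoUniformlyOn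
      (fun (m : ℕ) (p : ℝ × ℝ) => ∑ n ∈ Finset.range m,
        (((n : ℝ) + 1) * Real.pi / L) ^ 2 * (A (n + 1) p.1 + B (n + 1) p.1 + C (n + 1) p.1)
          * Real.sin (((n : ℝ) + 1) * Real.pi * p.2 / L))
      (fun p : ℝ × ℝ => ∑' n : ℕ,
        (((n : ℝ) + 1) * Real.pi / L) ^ 2 * (A (n + 1) p.1 + B (n + 1) p.1 + C (n + 1) p.1)
          * Real.sin (((n : ℝ) + 1) * Real.pi * p.2 / L))
      Filter.atTop (Set.Icc (0 : ℝ) T ×ˢ Set.Icc (0 : ℝ) L) ∧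
    (∀ t ∈ Set.Icc (0 : ℝ) T, ∀ x ∈ Set.Icc (0 : ℝ) L,
      HasDerivAt (fun ξ => v t ξ) (deriv (fun ξ => v t ξ) x) x ∧
      HasDerivAt (deriv (fun ξ => v t ξ))
        (∑' n : ℕ, -((((n : ℝ) + 1) * Real.pi / L) ^ 2
          * (A (n + 1) t + B (n + 1) t + C (n + 1) t)
          * Real.sin (((n : ℝ) + 1) * Real.pi * x / L))) x) ∧
    ContinuousOn (fun p : ℝ × ℝ => deriv (deriv (fun ξ => v p.1 ξ)) p.2)
      (Set.Icc (0 : ℝ) T ×ˢ Set.Icc (0 : ℝ) L) := by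
  have hτ0 : τ ≠ 0 := hτ.ne'
  have hKN : (K : ℝ) = N := by
    rw [hK, hT, mul_div_cancel_right₀ _ hτ0, Nat.ceil_natCast]
  have hrearr : ∀ (n : ℕ) (a : ℝ), (n : ℝ) * Real.pi * a / L = (n : ℝ) * (Real.pi * a / L) :=
    fun n a => by ring
  have hone : ∀ n : ℕ, (1 : ℝ) ≤ ((n + 1 : ℕ) : ℝ) := fun n => by
    exact_mod_cast Nat.succ_le_succ n.zero_le
  obtain ⟨c, hc, hcω⟩ := exists_mul_le_sqrt_sq_sub (p := Real.pi * a₁ / L) (d := d₁)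
    (by positivity) (by simpa using hpos₁ 1 one_pos)
  have hcω' : ∀ n : ℕ, c * ((n + 1 : ℕ) : ℝ) ≤ ω (n + 1) := fun n => by
    rw [hω, hrearr]
    exact hcω _ (hone n)
  have hω0 : ∀ n : ℕ, 0 < ω (n + 1) := fun n =>
    lt_of_lt_of_le (mul_pos hc (by linarith [hone n])) (hcω' n)
  set D := (Real.pi * a₂ / L) ^ 2 + |d₂|
  have hυD : ∀ n : ℕ, |-(υ (n + 1)) ^ 2| ≤ D * ((n + 1 : ℕ) : ℝ) ^ 2 := fun n => by
    have h := hpos₂ (n + 1) n.succ_pos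
    rw [hrearr] at h
    rw [abs_neg, abs_pow, sq_abs, hυ, hrearr]
    exact sq_sqrt_sq_sub_le (hone n) h.le
  obtain ⟨M, hM, hbound⟩ := abs_Cdel_Sdel_le (D := D) N hτ hc (by positivity)
  obtain ⟨M₁, hM₁⟩ := hdecay₁.bddAbove_range
  obtain ⟨M₂, hM₂⟩ := hdecay₂.bddAbove_range
  obtain ⟨M₃, hM₃⟩ := hdecay₃.bddAbove_range
  have hT0 : 0 ≤ T := by rw [hT]; positivity
  have hcoef : ∀ n : ℕ, ∀ t, A (n + 1) t + B (n + 1) t + C (n + 1) t = _ := fun n t => by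
    rw [hA, hB, hC]
  have hpow : ∀ (n : ℕ) (j : ℕ), ((n + 1 : ℕ) : ℝ) ^ ((K : ℝ) + (j + 1 : ℕ) + α) =
      ((n + 1 : ℕ) : ℝ) ^ N * ((n + 1 : ℕ) : ℝ) ^ j * ((n + 1 : ℕ) : ℝ) ^ (1 + α) :=
    fun n j => by
      have hn : 0 < ((n + 1 : ℕ) : ℝ) := by linarith [hone n]
      rw [← Real.rpow_natCast, ← Real.rpow_natCast, ← Real.rpow_add hn, ← Real.rpow_add hn, hKN]
      push_cast
      ring_nf
  have hu : Summable fun n : ℕ => (Real.pi / L) ^ 2 *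
      ((M * M₁ + D * τ * M * M₂ + T * M * M₃) * (1 / ((n + 1 : ℕ) : ℝ) ^ (1 + α))) :=
    (((summable_nat_add_iff 1).2
      (Real.summable_one_div_nat_rpow.2 (by linarith : 1 < 1 + α))).mul_left _).mul_left _
  refine sine_series_twice_differentiable hL hu
    (c := fun n t => A (n + 1) t + B (n + 1) t + C (n + 1) t) (fun n => ?_) (fun n t ht => ?_) hv _
  · simp_rw [hcoef]
    exact continuousOn_fourier_coefficient hτ hT (hω0 n) (hΦ _).continuousOn (hF _) _ _
  · have hn : 0 < ((n + 1 : ℕ) : ℝ) := by linarith [hone n]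
    have hP : 0 < ((n + 1 : ℕ) : ℝ) ^ (1 + α) := Real.rpow_pos_of_pos hn _
    obtain ⟨hCd, hSd⟩ := hbound (ω (n + 1)) (-(υ (n + 1)) ^ 2) _ (hone n) (hcω' n) (hυD n)
    rw [← hT] at hCd hSd
    have hest := abs_fourier_coefficient_le hτ ht (hone n) hM (hυD n) (hCd t ht) hSd
      (fun s hs => abs_le_biSup_Icc (hΦ (n + 1)).continuousOn hs)
      (fun s hs => abs_le_biSup_Icc (hF (n + 1)) hs)
      (le_refl (|Φ (n + 1) 0| + |derivWithin (Φ (n + 1)) (Set.Icc (-τ) (0 : ℝ)) 0|))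
    have h₁ := hM₁ (Set.mem_range_self (n + 1))
    have h₂ := hM₂ (Set.mem_range_self (n + 1))
    have h₃ := hM₃ (Set.mem_range_self (n + 1))
    have e3 := hpow n 2
    have e2 := hpow n 1
    norm_num only at e3 e2
    simp only [e3, e2, pow_one] at h₁ h₂ h₃
    rw [← hcoef] at hest
    calc (((n : ℝ) + 1) * Real.pi / L) ^ 2 * |A (n + 1) t + B (n + 1) t + C (n + 1) t|
        = (Real.pi / L) ^ 2 *
          (((n + 1 : ℕ) : ℝ) ^ 2 * |A (n + 1) t + B (n + 1) t + C (n + 1) t|) := by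
          push_cast
          ring
      _ ≤ _ := by
          rw [mul_one_div]
          gcongr
          rw [le_div_iff₀ hP]
          refine (mul_le_mul_of_nonneg_right hest hP.le).trans ?_
          have hDM : 0 ≤ D * τ * M := by positivity
          have hTM : 0 ≤ T * M := by positivity
          linarith [mul_le_mul_of_nonneg_left h₁ hM, mul_le_mul_of_nonneg_left h₂ hDM,
            mul_le_mul_of_nonneg_left h₃ hTM]
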